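/- Let R be a ring, G a class of left R-modules, m ≥ 1, and suppose the class F = {M : Ext^i_R(M, G) = 0 for all 1 ≤ i ≤ m, G ∈ G} defines a homological dimension. Then F = {M : Ext^i_R(M, G) = 0 for all i ≥ 1, G ∈ G}. -/

import Mathlib

open CategoryTheory

universe u

noncomputable section

variable {R : Type u} [Ring R]

/-- Membership in `F ∪ {0}`. -/
def MemF0 (F : ModuleCat.{u} R → Prop) (M : ModuleCat.{u} R) : Prop :=
  F M ∨ Subsingleton M

/-- There is a short exact sequence `0 → A → B → C → 0`. -/
def IsSES {R : Type u} [Ring R] (A B C : ModuleCat.{u} R) : Prop :=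
  ∃ (f : A ⟶ B) (g : B ⟶ C),
    Function.Injective f ∧ Function.Surjective g ∧ Function.Exact f g

/-- `FDimLE F n M` : `M` has left `F`-dimension `≤ n`, i.e. there is an exact sequence
`0 → F_n → ⋯ → F_0 → M → 0` with all `F_j ∈ F ∪ {0}`. -/
def FDimLE (F : ModuleCat.{u} R → Prop) : ℕ → ModuleCat.{u} R → Prop
  | 0, M => MemF0 F M
  | n + 1, M => ∃ K F0 : ModuleCat.{u} R, MemF0 F F0 ∧ IsSES K F0 M ∧ FDimLE F n K

/-- `M` admits a (possibly infinite) `F`-resolution `⋯ → F_1 → F_0 → M → 0`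
with all terms in `F ∪ {0}`. -/
def HasFRes (F : ModuleCat.{u} R → Prop) (M : ModuleCat.{u} R) : Prop :=
  ∃ K Fo : ℕ → ModuleCat.{u} R, K 0 = M ∧
    ∀ n, MemF0 F (Fo n) ∧ IsSES (K (n + 1)) (Fo n) (K n)

/-- `IsFKernel F n K X` : there is an exact sequence
`0 → K → F_n → ⋯ → F_0 → X → 0` with all `F_i ∈ F`. -/
def IsFKernel (F : ModuleCat.{u} R → Prop) : ℕ → ModuleCat.{u} R → ModuleCat.{u} R → Prop
  | 0, K, X => ∃ F0, F F0 ∧ IsSES K F0 X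
  | n + 1, K, X => ∃ K1 F0, F F0 ∧ IsSES K1 F0 X ∧ IsFKernel F n K K1

/-- The class `F` defines a homological dimension. -/
def DefinesHomDim (F : ModuleCat.{u} R → Prop) : Prop :=
  (∀ K Fm M : ModuleCat.{u} R, F Fm → IsSES K Fm M → HasFRes F M → HasFRes F K) ∧
  (∀ (n : ℕ) (K X : ModuleCat.{u} R), FDimLE F (n + 1) X → IsFKernel F n K X → F K)

/-- `M` is a homomorphic image of a module in `F`. -/
def IsImageOfF (F : ModuleCat.{u} R → Prop) (M : ModuleCat.{u} R) : Prop :=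
  ∃ F0 : ModuleCat.{u} R, F F0 ∧ ∃ g : F0 ⟶ M, Function.Surjective g

/-- `F` is closed under finite (binary) direct sums. -/
def ClosedUnderFinSums (F : ModuleCat.{u} R → Prop) : Prop :=
  ∀ A B : ModuleCat.{u} R, F A → F B → F (ModuleCat.of R (A × B))

/-- The class of homomorphic images of modules in `F` is closed under extensions. -/
def ImagesClosedUnderExt (F : ModuleCat.{u} R → Prop) : Prop :=
  ∀ (A B C : ModuleCat.{u} R) (f : A ⟶ B) (g : B ⟶ C),
    Function.Injective f → Function.Surjective g → Function.Exact f g →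
      IsImageOfF F A → IsImageOfF F C → IsImageOfF F B

/-- `Ext^i(M, N)` vanishes. -/
def ExtZero {R : Type u} [Ring R] (i : ℕ) (M N : ModuleCat.{u} R) : Prop :=
  Subsingleton (((Ext ℤ (ModuleCat.{u} R) i).obj (Opposite.op M)).obj N)

end
lemma extZero_iff_cond {R : Type u} [Ring R] {M : ModuleCat.{u} R} (P : ProjectiveResolution M)
    (N : ModuleCat.{u} R) (n : ℕ) :
    ExtZero (n + 1) M N ↔ ∀ f : P.complex.X (n + 1) ⟶ N, P.complex.d (n + 2) (n + 1) ≫ f = 0 →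
      ∃ h : P.complex.X n ⟶ N, P.complex.d (n + 1) n ≫ h = f := by
  have h1 : ExtZero (n + 1) M N ↔
      ((P.complex.linearYonedaObj ℤ N).sc' n (n+1) (n+2)).Exact := by
    unfold ExtZero
    rw [← ModuleCat.isZero_iff_subsingleton, (P.isoExt (R := ℤ) (n + 1) N).isZero_iff,
      ← HomologicalComplex.exactAt_iff_isZero_homology,
      HomologicalComplex.exactAt_iff' _ n (n+1) (n+2) (by simp) (by simp)]
  rw [h1, ShortComplex.moduleCat_exact_iff]
  rfl

lemma extZero_iff {R : Type u} [Ring R] (M N : ModuleCat.{u} R) (n : ℕ) :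
    ExtZero (n + 1) M N ↔ Subsingleton (Abelian.Ext.{u} M N (n + 1)) := by
  let P := ProjectiveResolution.of M
  rw [extZero_iff_cond P]
  constructor
  · intro H
    refine subsingleton_of_forall_eq 0 fun x => ?_
    obtain ⟨f, hf, rfl⟩ := P.extMk_surjective x (n + 2) rfl
    rw [P.extMk_eq_zero_iff f (n+2) rfl hf n rfl]
    exact H f hf
  · intro H f hf
    rw [← P.extMk_eq_zero_iff f (n+2) rfl hf n rfl]
    exact Subsingleton.elim _ _

theorem stmt9 {R : Type u} [Ring R] (G : ModuleCat.{u} R → Prop) (m : ℕ) (hm : 1 ≤ m)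
    (hF : DefinesHomDim (fun M : ModuleCat.{u} R =>
      ∀ i, 1 ≤ i → i ≤ m → ∀ g, G g → ExtZero i M g)) :
    ∀ M : ModuleCat.{u} R,
      (∀ i, 1 ≤ i → i ≤ m → ∀ g, G g → ExtZero i M g) ↔
      (∀ i, 1 ≤ i → ∀ g, G g → ExtZero i M g) := by
  intro M
  refine ⟨fun H i hi g hg => ?_, fun H i hi _ => H i hi⟩
  obtain ⟨n, rfl⟩ : ∃ n, i = n + 1 := ⟨i - 1, by omega⟩
  clear hi
  induction n generalizing M with
  | zero => exact H 1 le_rfl hm g hg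
  | succ n ih =>
    let S := ShortComplex.mk _ _ (Limits.kernel.condition (Projective.π M))
    have hS : S.ShortExact :=
      { exact := ShortComplex.exact_of_f_is_kernel _ (Limits.kernelIsKernel S.g) }
    have hK := hF.2 0 S.X₁ M
      ⟨ModuleCat.of R PUnit.{u+1}, M, Or.inl H, ⟨0, 𝟙 M, fun _ _ _ => rfl, fun x => ⟨x, rfl⟩, by
        intro x
        constructor
        · intro h
          have h0 : x = 0 := h
          subst h0
          exact ⟨PUnit.unit, rfl⟩
        · rintro ⟨y, rfl⟩
          rfl⟩, Or.inr (inferInstanceAs (Subsingleton PUnit))⟩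
      ⟨S.X₂, by
        intro j hj _ g _
        obtain ⟨k, rfl⟩ : ∃ k, j = k + 1 := ⟨j - 1, by omega⟩
        rw [extZero_iff]
        have : Projective S.X₂ := inferInstanceAs (Projective (Projective.over M))
        exact Abelian.Ext.subsingleton_of_projective _ _ _,
       S.f, S.g, (ModuleCat.mono_iff_injective _).1 hS.mono_f,
       (ModuleCat.epi_iff_surjective _).1 hS.epi_g,
       (ShortComplex.ShortExact.moduleCat_exact_iff_function_exact _).1 hS.exact⟩
    have h1 := (extZero_iff _ _ _).1 (ih S.X₁ hK)
    rw [extZero_iff]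
    refine subsingleton_of_forall_eq 0 fun x => ?_
    have : Projective S.X₂ := inferInstanceAs (Projective (Projective.over M))
    obtain ⟨y, rfl⟩ := Abelian.Ext.contravariant_sequence_exact₃ hS g x
      (Abelian.Ext.eq_zero_of_projective _) (n₀ := n + 1) (by omega)
    rw [Subsingleton.elim y 0, Abelian.Ext.comp_zero]
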